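/- arXiv:math-ph/9904008 — 2 statements merged into one kernel-verified Lean document; each statement's English description precedes it below -/
import Mathlib

section
/- Let n ≥ 1, let F : ℂⁿ → ℂ be an entire function (complex-analytic on all of ℂⁿ) that is not identically zero, and suppose there is E ∈ ℂ such that the Euler (radial) differential equation Σ_{j=1}^n z_j · ∂F/∂z_j (z) = E · F(z) holds for all z ∈ ℂⁿ (equivalently, the complex derivative of F at z applied to the vector z equals E·F(z)). Then E is a nonnegative integer N, and F is homogeneous of degree N: F(c·z) = c^N · F(z) for all c ∈ ℂ and z ∈ ℂⁿ; in particular F is a homogeneous polynomial of degree N. (This yields the energy spectrum E = Nħ of the geometrically quantized harmonic oscillator in the holomorphic representation, where the Hamiltonian operator acts as ħ Σ_j z_j ∂/∂z_j on holomorphic functions.) -/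
theorem euler_iter (g : ℂ → ℂ) (hg : Differentiable ℂ g) (E : ℂ)
    (h : ∀ t, t * deriv g t = E * g t) (k : ℕ) :
    ∀ t, t * iteratedDeriv (k + 1) g t = (E - k) * iteratedDeriv k g t := by
  have hd : ∀ m : ℕ, Differentiable ℂ (iteratedDeriv m g) := fun m =>
    (hg.contDiff (n := ((⊤ : ℕ∞) : WithTop ℕ∞))).differentiable_iteratedDeriv m (by exact_mod_cast ENat.natCast_lt_top m)
  induction k with
  | zero => intro t; simpa using h t
  | succ k ih =>
    intro t
    have h1 := congrArg (fun f => deriv f t) (funext ih)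
    have e1 : HasDerivAt (fun t => t * iteratedDeriv (k + 1) g t)
        (1 * iteratedDeriv (k + 1) g t + t * iteratedDeriv (k + 1 + 1) g t) t := by
      have := (hd (k + 1) t).hasDerivAt
      rw [← iteratedDeriv_succ] at this
      exact (hasDerivAt_id t).mul this
    have e2 : HasDerivAt (fun t => (E - k) * iteratedDeriv k g t)
        ((E - k) * iteratedDeriv (k + 1) g t) t := by
      have := (hd k t).hasDerivAt
      rw [← iteratedDeriv_succ] at this
      exact this.const_mul _
    simp only [e1.deriv, e2.deriv] at h1
    push_cast
    linear_combination h1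

theorem euler_coeff (g : ℂ → ℂ) (hg : Differentiable ℂ g) (E : ℂ)
    (h : ∀ t, t * deriv g t = E * g t) (k : ℕ) (hk : E ≠ k) : iteratedDeriv k g 0 = 0 := by
  have := euler_iter g hg E h k 0
  rw [zero_mul] at this
  exact (mul_eq_zero.mp this.symm).resolve_left (sub_ne_zero.mpr hk)

theorem euler_pow (g : ℂ → ℂ) (hg : Differentiable ℂ g) (N : ℕ)
    (h : ∀ t, t * deriv g t = (N : ℂ) * g t) (t : ℂ) : g t = t ^ N * g 1 := by
  have key : ∀ t, g t = (N.factorial : ℂ)⁻¹ * iteratedDeriv N g 0 * (t - 0) ^ N := by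
    intro t
    rw [← Complex.taylorSeries_eq_of_entire' 0 t hg, tsum_eq_single N]
    intro k hk
    rw [euler_coeff g hg N h k (by exact_mod_cast hk.symm)]
    simp
  rw [key t, key 1]
  simp
  ring

/-- If an entire function `F` on `ℂⁿ`, not identically zero, satisfies the Euler equation
`Σ_j z_j ∂F/∂z_j = E·F` (i.e. `(DF)(z)(z) = E·F(z)` for all `z`), then `E` is a nonnegative
integer `N` and `F` is homogeneous of degree `N`: `F(c•z) = c^N F(z)` for all `c ∈ ℂ`,
`z ∈ ℂⁿ`.  (This gives the energy spectrum `E = Nħ` of the geometrically quantized harmonic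
oscillator in the holomorphic representation.) -/
theorem stmt_16 (n : ℕ) (hn : 1 ≤ n) (F : (Fin n → ℂ) → ℂ)
    (hF : Differentiable ℂ F) (hne : ∃ z, F z ≠ 0) (E : ℂ)
    (heq : ∀ z, fderiv ℂ F z z = E * F z) :
    ∃ N : ℕ, E = (N : ℂ) ∧ ∀ (c : ℂ) (z : Fin n → ℂ), F (c • z) = c ^ N * F z := by
  have hgd : ∀ (z : Fin n → ℂ) (t : ℂ), HasDerivAt (fun t : ℂ => F (t • z)) (fderiv ℂ F (t • z) z) t := by
    intro z t
    have h2 : HasDerivAt (fun t : ℂ => t • z) z t := by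
      simpa using (hasDerivAt_id t).smul_const z
    exact (hF (t • z)).hasFDerivAt.comp_hasDerivAt t h2
  have hg : ∀ z : Fin n → ℂ, Differentiable ℂ (fun t : ℂ => F (t • z)) :=
    fun z t => (hgd z t).differentiableAt
  have hE : ∀ (z : Fin n → ℂ) (t : ℂ),
      t * deriv (fun t : ℂ => F (t • z)) t = E * F (t • z) := by
    intro z t
    rw [(hgd z t).deriv, ← heq (t • z), map_smul, smul_eq_mul]
  have hN : ∃ N : ℕ, E = N := by
    by_contra! hcon
    obtain ⟨z, hz⟩ := hne
    apply hz
    have := Complex.taylorSeries_eq_of_entire' 0 1 (hg z)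
    simp only [fun k => euler_coeff _ (hg z) E (hE z) k (hcon k)] at this
    simpa using this.symm
  obtain ⟨N, rfl⟩ := hN
  refine ⟨N, rfl, fun c z => ?_⟩
  simpa using euler_pow _ (hg z) N (hE z) c
end

section
/- Let f : (0,∞) × ℝ → ℂ be a continuous function which is differentiable in its second variable Θ, is 2π-periodic in Θ (f(r, Θ + 2π) = f(r, Θ) for all r > 0 and Θ ∈ ℝ), and satisfies the differential equation ∂f/∂Θ (r,Θ) = i π r² · f(r,Θ) for all (r,Θ). Then f is identically zero. (In the geometric quantization of the harmonic oscillator on ℝ² ∖ {0} with the polarization by circles, this is the statement that the equation ∂f/∂Θ − πi r² f = 0 for smooth single-valued functions has no nonzero solution, so the space of smooth polarized sections is zero.) -/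
/-- If `f : (0,∞) × ℝ → ℂ` is continuous, `2π`-periodic and differentiable in the angular
variable `Θ`, and satisfies `∂f/∂Θ = iπr²·f`, then `f` is identically zero.  (In the
geometric quantization of the harmonic oscillator with the polarization by circles, the
equation for polarized sections has no nonzero smooth single-valued solution.) -/
theorem stmt_17 (f : ℝ → ℝ → ℂ)
    (hcont : ContinuousOn (fun p : ℝ × ℝ => f p.1 p.2) (Set.Ioi 0 ×ˢ Set.univ))
    (hdiff : ∀ r > 0, ∀ Θ : ℝ,
      HasDerivAt (fun t => f r t) (Complex.I * (Real.pi : ℂ) * (r : ℂ) ^ 2 * f r Θ) Θ)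
    (hper : ∀ r > 0, ∀ Θ : ℝ, f r (Θ + 2 * Real.pi) = f r Θ) :
    ∀ r > 0, ∀ Θ : ℝ, f r Θ = 0 := by
  have key : ∀ r > 0, ∀ Θ : ℝ, f r Θ ≠ 0 → ∃ n : ℤ, r = Real.sqrt ((n : ℝ) / Real.pi) := by
    intro r hr Θ hne
    set c : ℂ := Complex.I * (Real.pi : ℂ) * (r : ℂ) ^ 2 with hc
    have hd : ∀ t : ℝ, HasDerivAt (fun t : ℝ => f r t * Complex.exp (-(c * (t : ℂ)))) 0 t := by
      intro t
      have h1 : HasDerivAt (fun t : ℝ => (t : ℂ)) 1 t := Complex.ofRealCLM.hasDerivAt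
      have h2 := ((h1.const_mul c).neg).cexp
      have h3 := (hdiff r hr t).mul h2
      refine HasDerivAt.congr_deriv h3 ?_
      rw [← hc]
      simp only [Pi.neg_apply]
      ring
    have h0 := is_const_of_deriv_eq_zero (fun t => (hd t).differentiableAt)
      (fun t => (hd t).deriv) (Θ + 2 * Real.pi) Θ
    rw [hper r hr Θ] at h0
    have h1 := mul_left_cancel₀ hne h0
    rw [Complex.exp_eq_exp_iff_exists_int] at h1
    obtain ⟨n, hn⟩ := h1
    refine ⟨-n, ?_⟩
    have hpi : (Real.pi : ℂ) ≠ 0 := by exact_mod_cast Real.pi_ne_zero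
    have h2 : (Real.pi : ℂ) * (r : ℂ) ^ 2 = -(n : ℂ) := by
      have h3 : (2 * (Real.pi : ℂ) * Complex.I) * ((Real.pi : ℂ) * (r : ℂ) ^ 2)
          = (2 * (Real.pi : ℂ) * Complex.I) * (-(n : ℂ)) := by
        rw [hc] at hn
        push_cast at hn
        linear_combination -hn
      exact mul_left_cancel₀ (mul_ne_zero (mul_ne_zero two_ne_zero hpi) Complex.I_ne_zero) h3
    have h4 : Real.pi * r ^ 2 = -(n : ℝ) := by exact_mod_cast h2
    have h5 : (((-n : ℤ) : ℝ) / Real.pi) = r ^ 2 := by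
      push_cast
      rw [← h4]
      field_simp
    rw [h5, Real.sqrt_sq (le_of_lt hr)]
  intro r hr Θ
  by_contra hne
  have hcount : (Set.range (fun n : ℤ => Real.sqrt ((n : ℝ) / Real.pi))).Countable :=
    Set.countable_range _
  have hdense := hcount.dense_compl ℝ
  have hca : ContinuousAt (fun p : ℝ × ℝ => f p.1 p.2) (r, Θ) :=
    hcont.continuousAt ((isOpen_Ioi.prod isOpen_univ).mem_nhds ⟨hr, trivial⟩)
  have hca' : ContinuousAt (fun s : ℝ => f s Θ) r :=
    ContinuousAt.comp (f := fun s : ℝ => (s, Θ)) hca (by fun_prop)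
  have hev := (hca'.eventually_ne hne).and (eventually_gt_nhds hr)
  obtain ⟨s, hs, hs'⟩ := hdense.inter_nhds_nonempty hev
  obtain ⟨n, hn⟩ := key _ (by first | exact hs.2 | exact hs'.2) Θ
    (by first | exact hs.1 | exact hs'.1)
  have hmem : s ∈ Set.range (fun n : ℤ => Real.sqrt ((n : ℝ) / Real.pi)) := ⟨n, hn.symm⟩
  first | exact hs hmem | exact hs' hmem
end
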